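/- Let (l₁,…,l_b̄) ∈ OP(n,b̄), let (b_k) be the sequence with b_k (k ≥ 1) the number of l_i equal to k and b₀ := b−b̄ for some b ≥ b̄, and let g ∈ ℕ₀. If β, β' ∈ Σ_b̄ both satisfy l_{β⁻¹(1)} ≤ ⋯ ≤ l_{β⁻¹(b̄)} and l_{β'⁻¹(1)} ≤ ⋯ ≤ l_{β'⁻¹(b̄)}, then the block permutations satisfy β'_{(l₁,…,l_b̄)} ∘ β_{(l₁,…,l_b̄)}⁻¹ ∈ Stab(\overline{(b_k)}^g), the Σ_n-stabilizer of the canonical representative \overline{(b_k)}^g in QO([n],2g+b−1). Consequently, for any multilinear map f : A^{⊗n} → k on a graded vector space A with f ∘ σ = f for all σ ∈ Stab(\overline{(b_k)}^g) (Σ_n acting with Koszul signs), one has f ∘ β_{(l₁,…,l_b̄)} = f ∘ β'_{(l₁,…,l_b̄)}. -/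

import Mathlib

open Finset

noncomputable section

namespace Paper

variable (k : Type) [Field k]

/-- `msign m = (−1)^m`. -/
def msign (m : ℤ) : k := if Odd m then -1 else 1

/-- The Koszul sign of the action of a permutation `τ` on a tensor product of
homogeneous factors of degrees `d i`. -/
def koszulSign {n : ℕ} (d : Fin n → ℤ) (τ : Equiv.Perm (Fin n)) : k :=
  ∏ i : Fin n, ∏ j : Fin n,
    if i < j ∧ τ j < τ i ∧ Odd (d i) ∧ Odd (d j) then (-1 : k) else (1 : k)

variable (ι : Type) [Fintype ι] [DecidableEq ι] (deg : ι → ℤ)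

/-- The `n`-th tensor power of the graded vector space with basis `ι`, in coordinates. -/
abbrev TPow (n : ℕ) : Type := (Fin n → ι) →₀ k

/-- The Koszul-signed action of `τ ∈ Σ_n` on `A^{⊗n}`. -/
def permAct {n : ℕ} (τ : Equiv.Perm (Fin n)) : TPow k ι n →ₗ[k] TPow k ι n :=
  Finsupp.lift (TPow k ι n) k (Fin n → ι)
    (fun I => koszulSign k (fun p => deg (I p)) τ • Finsupp.single (I ∘ τ.symm) (1 : k))

/-- A (potential) basis element of `QO([n],G)`: a genus together with a multiset
of cycles in `[n] = Fin n`. -/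
abbrev QOEl (n : ℕ) : Type := ℕ × Multiset (Cycle (Fin n))

/-- The relabeling action of `σ ∈ Σ_n` on basis elements. -/
def qoAct {n : ℕ} (σ : Equiv.Perm (Fin n)) (x : QOEl n) : QOEl n :=
  (x.1, x.2.map (Cycle.map σ))

/-- Consecutive blocks of given lengths starting at a given offset. -/
def blocksAux : ℕ → List ℕ → List (List ℕ)
  | _, [] => []
  | s, (m :: rest) => ((List.range m).map (s + ·)) :: blocksAux (s + m) rest

/-- The canonical representative `\overline{(b_k)}^g` of the `Σ_n`-orbit of basis
elements of `QO([n],2g+b−1)` with b-sequence `(b_k)`: the cycles are listed with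
nondecreasing lengths, every nonempty cycle is a cyclic interval of consecutive
integers, and all elements of an earlier cycle are smaller than those of a later
one. -/
def canonEl (n : ℕ) (hn : 0 < n) (bk : ℕ → ℕ) (g : ℕ) : QOEl n :=
  (g, ((blocksAux 0 ((List.range (n + 1)).flatMap (fun m => List.replicate (bk m) m))).map
    (fun L => ((L.map (fun x => (⟨x % n, Nat.mod_lt _ hn⟩ : Fin n)) : List (Fin n)) :
      Cycle (Fin n))) : List (Cycle (Fin n))))

/-- The b-sequence associated to an ordered partition `(l₁,…,l_b̄)` together with
`b₀` empty parts: `b_k` is the number of parts equal to `k` for `k ≥ 1`, and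
`b_0 := b₀`. -/
def bseqOf {bbar : ℕ} (l : Fin bbar → ℕ) (b₀ : ℕ) : ℕ → ℕ :=
  fun m => if m = 0 then b₀ else (Finset.univ.filter (fun i => l i = m)).card

/-- `σ ∈ Σ_n` is the block permutation `β_{(l₁,…,l_b̄)}` : it moves the `t`-th
consecutive block of `[n]` (of length `l t`, starting at `Σ_{t'<t} l t'`),
order-preservingly, to the position occupied by the `β(t)`-th block of the
reordered partition. -/
def IsBlockPerm (n : ℕ) {bbar : ℕ} (l : Fin bbar → ℕ) (β : Equiv.Perm (Fin bbar))
    (σ : Equiv.Perm (Fin n)) : Prop :=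
  ∀ (t : Fin bbar) (j : ℕ), j < l t →
    ∀ h1 : (∑ t' : Fin bbar, if t' < t then l t' else 0) + j < n,
      ((σ ⟨(∑ t' : Fin bbar, if t' < t then l t' else 0) + j, h1⟩ : Fin n) : ℕ) =
        (∑ t' : Fin bbar, if β t' < β t then l t' else 0) + j

/-- `β` sorts the partition `(l₁,…,l_b̄)` : `l_{β⁻¹(1)} ≤ ⋯ ≤ l_{β⁻¹(b̄)}`. -/
def SortsBlocks {bbar : ℕ} (l : Fin bbar → ℕ) (β : Equiv.Perm (Fin bbar)) : Prop :=
  Monotone (fun t => l (β.symm t))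

theorem koszulSign_mul {n : ℕ} (d : Fin n → ℤ) (τ σ : Equiv.Perm (Fin n)) :
    koszulSign k d σ * koszulSign k (fun p => d (σ.symm p)) τ = koszulSign k d (τ * σ) := by
  have h2 : koszulSign k (fun p => d (σ.symm p)) τ = ∏ i : Fin n, ∏ j : Fin n,
      if σ i < σ j ∧ τ (σ j) < τ (σ i) ∧ Odd (d i) ∧ Odd (d j) then (-1 : k) else (1 : k) := by
    unfold koszulSign
    rw [← Equiv.prod_comp σ]
    refine Finset.prod_congr rfl fun i _ => ?_
    rw [← Equiv.prod_comp σ]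
    simp
  have sym : ∀ G : Fin n → Fin n → k, (∀ i, G i i = 1) →
      ∏ i, ∏ j, G i j = ∏ i, ∏ j, if i < j then G i j * G j i else 1 := by
    intro G hG
    have e : ∀ i j, G i j = (if i < j then G i j else 1) * (if j < i then G i j else 1) := by
      intro i j
      rcases lt_trichotomy i j with h | h | h
      · simp [h, h.not_gt]
      · subst h; simp [hG]
      · simp [h, h.not_gt]
    calc ∏ i, ∏ j, G i j
        = ∏ i, ∏ j, ((if i < j then G i j else 1) * (if j < i then G i j else 1)) :=
          Finset.prod_congr rfl fun i _ => Finset.prod_congr rfl fun j _ => e i j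
      _ = (∏ i, ∏ j, (if i < j then G i j else 1)) * ∏ i, ∏ j, (if j < i then G i j else 1) := by
          simp only [Finset.prod_mul_distrib]
      _ = (∏ i, ∏ j, (if i < j then G i j else 1)) * ∏ i, ∏ j, (if i < j then G j i else 1) := by
          congr 1; exact Finset.prod_comm
      _ = _ := by
          simp only [← Finset.prod_mul_distrib]
          refine Finset.prod_congr rfl fun i _ => Finset.prod_congr rfl fun j _ => ?_
          split_ifs <;> simp
  rw [h2, sym _ (by simp)]
  unfold koszulSign
  simp only [← Finset.prod_mul_distrib]
  refine Finset.prod_congr rfl fun i _ => Finset.prod_congr rfl fun j _ => ?_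
  by_cases hij : i < j
  swap
  · simp [hij]
  by_cases ho : Odd (d i) ∧ Odd (d j)
  swap
  · have ho' : ¬ (Odd (d j) ∧ Odd (d i)) := fun h => ho ⟨h.2, h.1⟩
    simp [ho, ho']
  obtain ⟨hi, hj⟩ := ho
  have n1 : σ i ≠ σ j := fun h => hij.ne (σ.injective h)
  have n2 : τ (σ i) ≠ τ (σ j) := fun h => n1 (τ.injective h)
  simp only [hij, hi, hj, Equiv.Perm.mul_apply, true_and, and_true, if_true]
  rcases lt_or_gt_of_ne n1 with h | h <;> rcases lt_or_gt_of_ne n2 with h' | h' <;>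
    simp [h, h', h.not_gt, h'.not_gt]

theorem permAct_single {n : ℕ} (τ : Equiv.Perm (Fin n)) (I : Fin n → ι) (c : k) :
    permAct k ι deg τ (Finsupp.single I c) =
      c • koszulSign k (fun p => deg (I p)) τ • Finsupp.single (I ∘ τ.symm) (1 : k) := by
  simp [permAct]

theorem permAct_mul {n : ℕ} (τ σ : Equiv.Perm (Fin n)) :
    (permAct k ι deg τ).comp (permAct k ι deg σ) = permAct k ι deg (τ * σ) := by
  refine Finsupp.lhom_ext' fun I => LinearMap.ext_ring ?_
  simp only [LinearMap.comp_apply, Finsupp.lsingle_apply, permAct_single, map_smul,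
    smul_smul, one_mul]
  rw [← koszulSign_mul k (fun p => deg (I p)) τ σ]
  rfl

theorem blocksAux_ofFn (s m : ℕ) (f : Fin m → ℕ) :
    blocksAux s (List.ofFn f) = List.ofFn (fun i =>
      (List.range (f i)).map ((s + ∑ j, if j < i then f j else 0) + ·)) := by
  induction m generalizing s with
  | zero => simp [blocksAux]
  | succ m ih =>
    rw [List.ofFn_succ, List.ofFn_succ, blocksAux, ih]
    simp [Fin.sum_univ_succ, add_assoc]

theorem blocksAux_zero (s m : ℕ) (L : List ℕ) :
    blocksAux s (List.replicate m 0 ++ L) = List.replicate m [] ++ blocksAux s L := by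
  induction m with
  | zero => simp
  | succ m ih => simp [List.replicate_succ, blocksAux, ih]

theorem lens_eq {bbar : ℕ} (n : ℕ) (l : Fin bbar → ℕ) (hpos : ∀ i, 0 < l i)
    (hsum : ∑ i, l i = n) (b₀ : ℕ) (β : Equiv.Perm (Fin bbar)) (hβ : SortsBlocks l β) :
    (List.range (n + 1)).flatMap (fun m => List.replicate (bseqOf l b₀ m) m) =
      List.replicate b₀ 0 ++ List.ofFn (fun t => l (β.symm t)) := by
  have hle : ∀ i, l i ≤ n := fun i => hsum ▸ Finset.single_le_sum (fun _ _ => Nat.zero_le _) (Finset.mem_univ i)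
  refine List.Perm.eq_of_pairwise' (r := (· ≤ ·)) ?_ ?_ ?_
  · rw [List.pairwise_flatMap]
    refine ⟨fun a _ => ?_, ?_⟩
    · simp [List.pairwise_replicate]
    · refine List.pairwise_lt_range.imp ?_
      intro a b hab x hx y hy
      rw [List.eq_of_mem_replicate hx, List.eq_of_mem_replicate hy]
      exact hab.le
  · rw [List.pairwise_append]
    refine ⟨by simp [List.pairwise_replicate], ?_, ?_⟩
    · rw [List.pairwise_ofFn]
      intro i j hij
      exact hβ hij.le
    · intro a ha b _
      rw [List.eq_of_mem_replicate ha]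
      exact Nat.zero_le _
  · rw [List.perm_iff_count]
    intro a
    have c1 : List.count a (List.ofFn (fun t => l (β.symm t))) =
        (Finset.univ.filter (fun i => l i = a)).card := by
      have : (List.ofFn (fun t => l (β.symm t)) : List ℕ) =
          (List.finRange bbar).map (fun t => l (β.symm t)) := by simp [List.ofFn_eq_map]
      rw [this]
      have h2 : List.count a ((List.finRange bbar).map (fun t => l (β.symm t))) =
          Multiset.count a ((Finset.univ : Finset (Fin bbar)).val.map (fun t => l (β.symm t))) := by
        rw [← Multiset.coe_count]; rfl
      rw [h2, Multiset.count_map]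
      change (Finset.univ.filter (fun t => a = l (β.symm t))).card = _
      refine Finset.card_equiv β.symm ?_
      intro i
      simp [eq_comm]
    have c2 : List.count a ((List.range (n + 1)).flatMap
        (fun m => List.replicate (bseqOf l b₀ m) m)) = if a < n + 1 then bseqOf l b₀ a else 0 := by
      rw [List.count_flatMap]
      have : (List.count a ∘ fun m => List.replicate (bseqOf l b₀ m) m) =
          fun m => if m = a then bseqOf l b₀ a else 0 := by
        funext m
        simp only [Function.comp, List.count_replicate]
        by_cases h : m = a <;> simp [h]
      rw [this]
      change (Multiset.map _ (Finset.range (n + 1)).val).sum = _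
      change (∑ m ∈ Finset.range (n + 1), if m = a then bseqOf l b₀ a else 0) = _
      simp [Nat.lt_succ_iff]
    rw [c2, List.count_append, c1, List.count_replicate]
    by_cases h0 : a = 0
    · subst h0
      have : ∀ i, l i ≠ 0 := fun i => (hpos i).ne'
      simp [bseqOf, this]
    · by_cases hn : a < n + 1
      · simp [bseqOf, h0, hn, Ne.symm h0]
      · have : ∀ i, l i ≠ a := fun i h => hn (by have := hle i; omega)
        simp [hn, this, Ne.symm h0]

theorem canonEl_eq {bbar : ℕ} (n : ℕ) (hn : 0 < n) (l : Fin bbar → ℕ) (hpos : ∀ i, 0 < l i)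
    (hsum : ∑ i, l i = n) (b₀ g : ℕ) (β : Equiv.Perm (Fin bbar)) (hβ : SortsBlocks l β) :
    canonEl n hn (bseqOf l b₀) g = (g, Multiset.replicate b₀ (Cycle.nil) +
      (Finset.univ : Finset (Fin bbar)).val.map (fun t =>
        (((List.range (l t)).map (fun j =>
          (⟨((∑ t' : Fin bbar, if β t' < β t then l t' else 0) + j) % n, Nat.mod_lt _ hn⟩ : Fin n)) :
            List (Fin n)) : Cycle (Fin n)))) := by
  unfold canonEl
  rw [lens_eq n l hpos hsum b₀ β hβ, blocksAux_zero, blocksAux_ofFn]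
  refine Prod.ext rfl ?_
  simp only [List.map_append, List.map_replicate, ← Multiset.coe_add]
  congr 1
  rw [List.map_ofFn, List.ofFn_eq_map]
  have e : (Finset.univ : Finset (Fin bbar)).val = (Finset.univ : Finset (Fin bbar)).val.map β := by
    have := congrArg Finset.val (Finset.map_univ_equiv β)
    simpa using this.symm
  change Multiset.map _ (Finset.univ : Finset (Fin bbar)).val = _
  rw [e, Multiset.map_map, ← e]
  refine Multiset.map_congr rfl fun t _ => ?_
  have hs : (∑ j, if j < β t then l (β.symm j) else 0) =
      ∑ t' : Fin bbar, if β t' < β t then l t' else 0 := by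
    rw [← Equiv.sum_comp β]; simp
  simp only [Function.comp, Equiv.symm_apply_apply, List.map_map, hs, zero_add]
  rfl

end Paper

namespace Paper

/-- let `(l₁,…,l_b̄) ∈ OP(n,b̄)`, let `(b_k)` be its b-sequence
(`b₀ := b − b̄`), `g ∈ ℕ₀`.  If `β, β'` both sort `(l)`, then the block
permutations satisfy `β'_{(l)} ∘ β_{(l)}⁻¹ ∈ Stab(\overline{(b_k)}^g)`;
consequently, any multilinear map `f : A^{⊗n} → k` invariant (with Koszul signs)
under `Stab(\overline{(b_k)}^g)` satisfies `f ∘ β_{(l)} = f ∘ β'_{(l)}`. -/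
theorem statement16 {k : Type} [Field k] {ι : Type} [Fintype ι] [DecidableEq ι]
    (deg : ι → ℤ)
    (n bbar : ℕ) (hb : 1 ≤ bbar) (l : Fin bbar → ℕ)
    (hpos : ∀ i, 0 < l i) (hsum : ∑ i, l i = n) (hn : 0 < n)
    (b b₀ g : ℕ) (hbb : bbar ≤ b) (hb₀ : b₀ = b - bbar)
    (β β' : Equiv.Perm (Fin bbar)) (hβ : SortsBlocks l β) (hβ' : SortsBlocks l β')
    (σ σ' : Equiv.Perm (Fin n))
    (hσ : IsBlockPerm n l β σ) (hσ' : IsBlockPerm n l β' σ') :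
    qoAct (σ' * σ⁻¹) (canonEl n hn (bseqOf l b₀) g) = canonEl n hn (bseqOf l b₀) g ∧
    (∀ f : TPow k ι n →ₗ[k] k,
      (∀ τ : Equiv.Perm (Fin n),
        qoAct τ (canonEl n hn (bseqOf l b₀) g) = canonEl n hn (bseqOf l b₀) g →
        f.comp (permAct k ι deg τ) = f) →
      f.comp (permAct k ι deg σ) = f.comp (permAct k ι deg σ')) := by
  have hlt : ∀ (t : Fin bbar) (j : ℕ), j < l t →
      (∑ t' : Fin bbar, if t' < t then l t' else 0) + j < n := by
    intro t j hj
    have : (∑ t' : Fin bbar, if t' < t then l t' else 0) + l t ≤ n := by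
      rw [← hsum]
      have h2 : l t = ∑ t' : Fin bbar, if t' = t then l t' else 0 := by simp
      rw [h2, ← Finset.sum_add_distrib]
      refine Finset.sum_le_sum fun i _ => ?_
      by_cases h : i = t
      · subst h; simp
      · simp only [h, if_false]; split_ifs <;> omega
    omega
  have main : qoAct (σ' * σ⁻¹) (canonEl n hn (bseqOf l b₀) g) = canonEl n hn (bseqOf l b₀) g := by
    conv_lhs => rw [canonEl_eq n hn l hpos hsum b₀ g β hβ]
    rw [canonEl_eq n hn l hpos hsum b₀ g β' hβ']
    unfold qoAct
    refine Prod.ext rfl ?_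
    simp only [Multiset.map_add, Multiset.map_replicate, Cycle.map_nil, Multiset.map_map]
    congr 1
    refine Multiset.map_congr rfl fun t _ => ?_
    simp only [Function.comp, Cycle.map_coe, List.map_map]
    congr 1
    refine List.map_congr_left fun j hj => ?_
    have hj' := List.mem_range.1 hj
    have h1 := hlt t j hj'
    have a := hσ t j hj' h1
    have a' := hσ' t j hj' h1
    have e1 : (⟨((∑ t' : Fin bbar, if β t' < β t then l t' else 0) + j) % n, Nat.mod_lt _ hn⟩ : Fin n)
        = σ ⟨_, h1⟩ := by
      apply Fin.ext
      simp only [← a]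
      exact Nat.mod_eq_of_lt (Fin.isLt _)
    have e2 : (⟨((∑ t' : Fin bbar, if β' t' < β' t then l t' else 0) + j) % n, Nat.mod_lt _ hn⟩ : Fin n)
        = σ' ⟨_, h1⟩ := by
      apply Fin.ext
      simp only [← a']
      exact Nat.mod_eq_of_lt (Fin.isLt _)
    simp only [Function.comp]
    rw [e1, e2]
    simp
  refine ⟨main, fun f hf => ?_⟩
  have h := hf _ main
  have h2 := permAct_mul k ι deg (σ' * σ⁻¹) σ
  rw [inv_mul_cancel_right] at h2
  rw [← h2, ← LinearMap.comp_assoc, h]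

end Paper
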